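/- arXiv:2106.03189 — 8 statements merged into one kernel-verified Lean document; each statement's English description precedes it below -/
import Mathlib

section
/- A continuous function F : ℝ^n → ℝ is the disjoint-pair Lovász extension of some function f : 𝒫₂(V) → ℝ with f(∅,∅) = 0 (i.e., F = f^L) if and only if F(x + y) = F(x) + F(y) whenever x and y are absolutely comonotonic, i.e., x_i y_i ≥ 0 for all i ∈ V and (|x_i| − |x_j|)(|y_i| − |y_j|) ≥ 0 for all i, j ∈ V. -/
open MeasureTheory Finset

/-- The disjoint-pair Lovász extension of `f : 𝒫₂(V) → ℝ` (with `f(∅,∅) = 0`):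
`f^L(x) = ∫_0^{‖x‖_∞} f(V₊^t(x), V₋^t(x)) dt`, where `V₊^t(x) = {i : x_i > t}` and
`V₋^t(x) = {i : −x_i > t}`. -/
noncomputable def dpLovasz {n : ℕ} (f : Finset (Fin n) → Finset (Fin n) → ℝ)
    (x : Fin n → ℝ) : ℝ :=
  ∫ t in (0 : ℝ)..(⨆ i, |x i|),
    f (univ.filter fun i => t < x i) (univ.filter fun i => t < -x i)

/-- `x` and `y` are absolutely comonotonic: `x_i y_i ≥ 0` for all `i` and
`(|x_i| − |x_j|)(|y_i| − |y_j|) ≥ 0` for all `i, j`. -/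
def AbsComonotone {n : ℕ} (x y : Fin n → ℝ) : Prop :=
  (∀ i, 0 ≤ x i * y i) ∧ ∀ i j, 0 ≤ (|x i| - |x j|) * (|y i| - |y j|)

/-- `x` has signs `s`, and its absolute values are listed in increasing order by `a`, the entry `i`
standing at position `r i + 1`. -/
structure IsRanked {n : ℕ} (s : Fin n → ℝ) (r : Fin n → ℕ) (a : ℕ → ℝ) (x : Fin n → ℝ) :
    Prop where
  mono : Monotone a
  zero : a 0 = 0
  eq : ∀ i, x i = s i * a (r i + 1)

namespace IsRanked

variable {n : ℕ} {s : Fin n → ℝ} {r : Fin n → ℕ} {a b : ℕ → ℝ} {x y : Fin n → ℝ}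

theorem nonneg (h : IsRanked s r a x) (k : ℕ) : 0 ≤ a k :=
  h.zero ▸ h.mono (Nat.zero_le k)

theorem add (hx : IsRanked s r a x) (hy : IsRanked s r b y) :
    IsRanked s r (a + b) (x + y) where
  mono := hx.mono.add hy.mono
  zero := by simp [hx.zero, hy.zero]
  eq i := by simp [hx.eq i, hy.eq i, mul_add]

theorem abs_eq (h : IsRanked s r a x) (hs : ∀ i, s i = 1 ∨ s i = -1) (i : Fin n) :
    |x i| = a (r i + 1) := by
  rw [h.eq, abs_mul, abs_of_nonneg (h.nonneg _)]
  rcases hs i with h | h <;> simp [h]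

theorem iSup_abs_eq (h : IsRanked s r a x) (hs : ∀ i, s i = 1 ∨ s i = -1)
    (hr : ∀ i, r i < n) (htop : ∃ i, r i + 1 = n) : ⨆ i, |x i| = a n := by
  obtain ⟨i₀, hi₀⟩ := htop
  have : Nonempty (Fin n) := ⟨i₀⟩
  apply le_antisymm
  · exact ciSup_le fun i => (h.abs_eq hs i).trans_le (h.mono (hr i))
  · have h0 := h.abs_eq hs i₀
    rw [hi₀] at h0
    rw [← h0]
    exact le_ciSup (f := fun i => |x i|) (Set.finite_range _).bddAbove i₀

theorem filter_lt_eq (h : IsRanked s r a x) (hs : ∀ i, s i = 1 ∨ s i = -1) {k : ℕ} {t : ℝ}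
    (ht : t ∈ Set.Ioo (a k) (a (k + 1))) :
    (univ.filter fun i => t < x i) = (univ.filter fun i => k ≤ r i ∧ s i = 1) ∧
    (univ.filter fun i => t < -x i) = (univ.filter fun i => k ≤ r i ∧ s i = -1) := by
  have ht0 : 0 < t := (h.nonneg k).trans_lt ht.1
  have key (i : Fin n) : t < a (r i + 1) ↔ k ≤ r i := by
    constructor
    · intro hlt
      by_contra! hk
      exact (hlt.trans_le (h.mono hk)).not_gt ht.1
    · intro hk
      exact ht.2.trans_le (h.mono (by omega))
  constructor <;> ext i <;> simp only [mem_filter, mem_univ, true_and, ← key i, h.eq i] <;>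
    have := h.nonneg (r i + 1) <;> rcases hs i with h1 | h1 <;> rw [h1] <;> norm_num <;> linarith

theorem dpLovasz_eq_sum (h : IsRanked s r a x) (hs : ∀ i, s i = 1 ∨ s i = -1)
    (hr : ∀ i, r i < n) (htop : ∃ i, r i + 1 = n)
    (f : Finset (Fin n) → Finset (Fin n) → ℝ) :
    dpLovasz f x = ∑ k ∈ range n, (a (k + 1) - a k) *
      f (univ.filter fun i => k ≤ r i ∧ s i = 1) (univ.filter fun i => k ≤ r i ∧ s i = -1) := by
  have hae (k : ℕ) : ∀ᵐ t : ℝ, t ∈ Set.uIoc (a k) (a (k + 1)) →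
      f (univ.filter fun i => t < x i) (univ.filter fun i => t < -x i) =
      f (univ.filter fun i => k ≤ r i ∧ s i = 1) (univ.filter fun i => k ≤ r i ∧ s i = -1) := by
    filter_upwards [Measure.ae_ne volume (a (k + 1))] with t hne ht
    rw [Set.uIoc_of_le (h.mono k.le_succ)] at ht
    obtain ⟨h1, h2⟩ := h.filter_lt_eq hs ⟨ht.1, lt_of_le_of_ne ht.2 hne⟩
    rw [h1, h2]
  rw [dpLovasz, h.iSup_abs_eq hs hr htop, ← h.zero,
    ← intervalIntegral.sum_integral_adjacent_intervals]
  · refine Finset.sum_congr rfl fun k _ => ?_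
    rw [intervalIntegral.integral_congr_ae (hae k), intervalIntegral.integral_const, smul_eq_mul]
  · intro k _
    have hk := (ae_restrict_iff' measurableSet_uIoc).2 (hae k)
    exact intervalIntegrable_const.congr_ae (Filter.EventuallyEq.symm hk)

end IsRanked

namespace AbsComonotone

variable {n : ℕ} {x y : Fin n → ℝ}

theorem smul_smul (x : Fin n → ℝ) {c d : ℝ} (hc : 0 ≤ c) (hd : 0 ≤ d) :
    AbsComonotone (c • x) (d • x) := by
  have hcd := mul_nonneg hc hd
  constructor
  · intro i
    have := mul_nonneg hcd (mul_self_nonneg (x i))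
    simp only [Pi.smul_apply, smul_eq_mul]
    linarith
  · intro i j
    have := mul_nonneg hcd (mul_self_nonneg (|x i| - |x j|))
    simp only [Pi.smul_apply, smul_eq_mul, abs_mul, abs_of_nonneg hc, abs_of_nonneg hd]
    linarith

theorem refl (x : Fin n → ℝ) : AbsComonotone x x := by
  simpa using smul_smul x zero_le_one zero_le_one

theorem exists_sign (h : AbsComonotone x y) :
    ∃ s : Fin n → ℝ, (∀ i, s i = 1 ∨ s i = -1) ∧
      (∀ i, x i = s i * |x i|) ∧ ∀ i, y i = s i * |y i| := by
  have (i : Fin n) : ∃ c : ℝ, (c = 1 ∨ c = -1) ∧ x i = c * |x i| ∧ y i = c * |y i| := by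
    rcases mul_nonneg_iff.1 (h.1 i) with ⟨h1, h2⟩ | ⟨h1, h2⟩
    · exact ⟨1, .inl rfl, by rw [abs_of_nonneg h1, one_mul], by rw [abs_of_nonneg h2, one_mul]⟩
    · exact ⟨-1, .inr rfl, by rw [abs_of_nonpos h1]; ring, by rw [abs_of_nonpos h2]; ring⟩
  choose s hs using this
  exact ⟨s, fun i => (hs i).1, fun i => (hs i).2.1, fun i => (hs i).2.2⟩

theorem exists_perm (h : AbsComonotone x y) :
    ∃ σ : Equiv.Perm (Fin n), Monotone (fun i => |x (σ i)|) ∧ Monotone fun i => |y (σ i)| := by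
  let u : Fin n → ℝ := fun i => |x i| + |y i|
  have hmono : Monotone (u ∘ Tuple.sort u) := Tuple.monotone_sort u
  refine ⟨Tuple.sort u, fun i j hij => ?_, fun i j hij => ?_⟩ <;>
  · have h1 := hmono hij
    have h2 := h.2 (Tuple.sort u i) (Tuple.sort u j)
    simp only [Function.comp_apply, u] at h1 h2 ⊢
    by_contra! hlt
    nlinarith

theorem exists_isRanked (hn : 0 < n) (h : AbsComonotone x y) :
    ∃ (s : Fin n → ℝ) (r : Fin n → ℕ) (a b : ℕ → ℝ), (∀ i, s i = 1 ∨ s i = -1) ∧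
      (∀ i, r i < n) ∧ (∃ i, r i + 1 = n) ∧ IsRanked s r a x ∧ IsRanked s r b y := by
  obtain ⟨s, hs, hsx, hsy⟩ := h.exists_sign
  obtain ⟨σ, hσx, hσy⟩ := h.exists_perm
  let p : ℕ → Fin n := fun k => ⟨min k (n - 1), by omega⟩
  have hp : Monotone p := fun k l hkl => by
    simp only [p, Fin.mk_le_mk]
    omega
  have hpi (i : Fin n) : p i = i := by
    ext
    simp only [p]
    omega
  have key (z : Fin n → ℝ) (hz : Monotone fun i => |z (σ i)|) (hsz : ∀ i, z i = s i * |z i|) :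
      IsRanked s (fun i => σ.symm i) (fun k => Nat.casesOn k 0 fun j => |z (σ (p j))|) z := by
    refine ⟨monotone_nat_of_le_succ fun k => ?_, rfl, fun i => ?_⟩
    · cases k with
      | zero => exact abs_nonneg _
      | succ k => exact hz (hp k.le_succ)
    · simpa [hpi] using hsz i
  refine ⟨s, _, _, _, hs, fun i => (σ.symm i).2, ⟨σ ⟨n - 1, by omega⟩, ?_⟩,
    key x hσx hsx, key y hσy hsy⟩
  simp only [Equiv.symm_apply_apply]
  omega

end AbsComonotone

theorem dpLovasz_add {n : ℕ} (hn : 0 < n) (f : Finset (Fin n) → Finset (Fin n) → ℝ)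
    {x y : Fin n → ℝ} (h : AbsComonotone x y) :
    dpLovasz f (x + y) = dpLovasz f x + dpLovasz f y := by
  obtain ⟨s, r, a, b, hs, hr, htop, hx, hy⟩ := h.exists_isRanked hn
  rw [(hx.add hy).dpLovasz_eq_sum hs hr htop, hx.dpLovasz_eq_sum hs hr htop,
    hy.dpLovasz_eq_sum hs hr htop, ← Finset.sum_add_distrib]
  refine Finset.sum_congr rfl fun k _ => ?_
  simp only [Pi.add_apply]
  ring

/-- A continuous function that is additive on the nonnegative half-line is linear there. -/
theorem eq_mul_of_continuous_of_add_nonneg {h : ℝ → ℝ} (hc : Continuous h)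
    (hadd : ∀ c d, 0 ≤ c → 0 ≤ d → h (c + d) = h c + h d) {c : ℝ} (hc0 : 0 ≤ c) :
    h c = c * h 1 := by
  have h0 : h 0 = 0 := by simpa using hadd 0 0 le_rfl le_rfl
  let g : ℝ →+ ℝ :=
    { toFun := fun c => h (max c 0) - h (max (-c) 0)
      map_zero' := by simp
      map_add' := fun c d => by
        have p (z : ℝ) : 0 ≤ max z 0 := le_max_right _ _
        have q (z : ℝ) : max z 0 - max (-z) 0 = z := by
          rcases le_total z 0 with hz | hz
          · rw [max_eq_right hz, max_eq_left (by linarith)]; ring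
          · rw [max_eq_left hz, max_eq_right (by linarith)]; ring
        have e : max (c + d) 0 + (max (-c) 0 + max (-d) 0) =
            max (-(c + d)) 0 + (max c 0 + max d 0) := by
          linarith [q c, q d, q (c + d)]
        have e' := congrArg h e
        rw [hadd _ _ (p _) (add_nonneg (p _) (p _)), hadd _ _ (p _) (p _),
          hadd _ _ (p _) (add_nonneg (p _) (p _)), hadd _ _ (p _) (p _)] at e'
        linarith }
  have hg : Continuous g := by
    change Continuous fun c => h (max c 0) - h (max (-c) 0)
    fun_prop
  have hval (z : ℝ) (hz : 0 ≤ z) : g z = h z := by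
    change h (max z 0) - h (max (-z) 0) = h z
    rw [max_eq_left hz, max_eq_right (by linarith), h0, sub_zero]
  have := map_real_smul g hg c 1
  rwa [smul_eq_mul, mul_one, smul_eq_mul, hval c hc0, hval 1 zero_le_one] at this

section Additive

variable {n : ℕ} {F : (Fin n → ℝ) → ℝ}

theorem map_smul_of_absComonotone_add (hF : Continuous F)
    (hadd : ∀ x y : Fin n → ℝ, AbsComonotone x y → F (x + y) = F x + F y)
    {c : ℝ} (hc : 0 ≤ c) (x : Fin n → ℝ) : F (c • x) = c * F x := by
  have := eq_mul_of_continuous_of_add_nonneg (h := fun c => F (c • x)) (by fun_prop)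
    (fun c d hc hd => by
      simpa only [add_smul] using hadd _ _ (AbsComonotone.smul_smul x hc hd)) hc
  simpa using this

theorem map_zero_of_absComonotone_add
    (hadd : ∀ x y : Fin n → ℝ, AbsComonotone x y → F (x + y) = F x + F y) :
    F (fun _ => 0) = 0 := by
  have : F (0 : Fin n → ℝ) = 0 := by simpa using hadd 0 0 (AbsComonotone.refl 0)
  exact this

theorem IsRanked.map_truncate_eq_sum (hF : Continuous F)
    (hadd : ∀ x y : Fin n → ℝ, AbsComonotone x y → F (x + y) = F x + F y)
    {s : Fin n → ℝ} {r : Fin n → ℕ} {a : ℕ → ℝ} {x : Fin n → ℝ} (h : IsRanked s r a x)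
    (hs : ∀ i, s i = 1 ∨ s i = -1) (k : ℕ) :
    F (fun i => s i * a (min k (r i + 1))) =
      ∑ j ∈ range k, (a (j + 1) - a j) * F (fun i => if j ≤ r i then s i else 0) := by
  induction k with
  | zero =>
    simpa [h.zero] using map_zero_of_absComonotone_add hadd
  | succ k ih =>
    have hd : 0 ≤ a (k + 1) - a k := sub_nonneg.2 (h.mono k.le_succ)
    have habs (i : Fin n) : |s i| = 1 := by rcases hs i with h | h <;> simp [h]
    have hsq (i : Fin n) : s i * s i = 1 := by rcases hs i with h | h <;> simp [h]
    rw [sum_range_succ, ← ih, ← map_smul_of_absComonotone_add hF hadd hd, ← hadd]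
    · congr 1
      ext i
      simp only [Pi.add_apply, Pi.smul_apply, smul_eq_mul]
      split_ifs with hk
      · rw [min_eq_left (by omega), min_eq_left (by omega)]
        ring
      · rw [min_eq_right (by omega), min_eq_right (by omega)]
        ring
    · constructor
      · intro i
        simp only [Pi.smul_apply, smul_eq_mul]
        split_ifs
        · have := mul_nonneg (h.nonneg (min k (r i + 1))) hd
          calc 0 ≤ s i * s i * (a (min k (r i + 1)) * (a (k + 1) - a k)) := by
                rwa [hsq, one_mul]
            _ = _ := by ring
        · simp
      · intro i j
        simp only [Pi.smul_apply, smul_eq_mul, abs_mul, habs, one_mul,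
          abs_of_nonneg (h.nonneg _), abs_of_nonneg hd]
        split_ifs with hi hj hj
        · simp [habs]
        · rw [habs, abs_zero]
          have := h.mono (show min k (r j + 1) ≤ min k (r i + 1) by omega)
          nlinarith
        · rw [habs, abs_zero]
          have := h.mono (show min k (r i + 1) ≤ min k (r j + 1) by omega)
          nlinarith
        · simp

theorem eq_dpLovasz_of_absComonotone_add (hn : 0 < n) (hF : Continuous F)
    (hadd : ∀ x y : Fin n → ℝ, AbsComonotone x y → F (x + y) = F x + F y) :
    F = dpLovasz fun A B => F fun i => if i ∈ A then 1 else if i ∈ B then -1 else 0 := by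
  ext x
  obtain ⟨s, r, a, -, hs, hr, htop, hx, -⟩ := (AbsComonotone.refl x).exists_isRanked hn
  have hsum := hx.map_truncate_eq_sum hF hadd hs n
  have hxe : (fun i => s i * a (min n (r i + 1))) = x := by
    ext i
    rw [min_eq_right (hr i), hx.eq]
  rw [hxe] at hsum
  rw [hsum, hx.dpLovasz_eq_sum hs hr htop]
  refine Finset.sum_congr rfl fun k _ => ?_
  congr 2
  ext i
  rcases hs i with h | h <;> by_cases hk : k ≤ r i <;> norm_num [h, hk]

end Additive

/-- A continuous `F : ℝ^n → ℝ` is the disjoint-pair Lovász extension of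
some `f : 𝒫₂(V) → ℝ` with `f(∅,∅) = 0` iff `F(x + y) = F(x) + F(y)` whenever `x` and `y`
are absolutely comonotonic. -/
theorem stmt_5 {n : ℕ} (hn : 0 < n) (F : (Fin n → ℝ) → ℝ) (hF : Continuous F) :
    (∃ f : Finset (Fin n) → Finset (Fin n) → ℝ, f ∅ ∅ = 0 ∧ F = dpLovasz f) ↔
      ∀ x y : Fin n → ℝ, AbsComonotone x y → F (x + y) = F x + F y := by
  constructor
  · rintro ⟨f, -, rfl⟩ x y hxy
    exact dpLovasz_add hn f hxy
  · intro hadd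
    refine ⟨_, ?_, eq_dpLovasz_of_absComonotone_add hn hF hadd⟩
    simpa using map_zero_of_absComonotone_add hadd
end

section
/- Let h : 𝒫(V) → [0,∞) with h(∅) = 0 and let f : 𝒫₂(V) → [0,∞) with f(∅,∅) = 0. Then: (a) if f(A,B) = h(A) + h(V∖B) − h(V) for all (A,B) ∈ 𝒫₂(V), then the disjoint-pair Lovász extension f^L equals the original Lovász extension h^L on all of ℝ^n; (b) if f(A,B) = h(A) + h(B) for all (A,B) ∈ 𝒫₂(V) and h is symmetric, i.e., h(A) = h(V∖A) for all A ⊆ V, then f^L = h^L on ℝ^n; (c) if f(A,B) = h(A) + h(B) (respectively f(A,B) = h(A) − h(B)) for all (A,B) ∈ 𝒫₂(V), then f^L(x) = h^L(x⁺) + h^L(x⁻) (respectively f^L(x) = h^L(x⁺) − h^L(x⁻)) for all x ∈ ℝ^n, where x⁺ = max(x, 0) and x⁻ = max(−x, 0) componentwise. -/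
open MeasureTheory Finset

/-- The (original) Lovász extension of a set function `h : 𝒫(V) → ℝ`. -/
noncomputable def lovasz {n : ℕ} (f : Finset (Fin n) → ℝ) (x : Fin n → ℝ) : ℝ :=
  (∫ t in (⨅ i, x i)..(⨆ i, x i), f (univ.filter fun i => t < x i)) +
    f univ * (⨅ i, x i)

/-- Set functions of the superlevel sets `{i | t < x i}` depend measurably on `t`. -/
theorem measurable_superlevel {n : ℕ} (h : Finset (Fin n) → ℝ) (x : Fin n → ℝ) :
    Measurable fun t : ℝ => h (univ.filter fun i => t < x i) := by
  let _ : MeasurableSpace (Finset (Fin n)) := ⊤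
  have hmeas : Measurable fun t : ℝ => univ.filter fun i => t < x i := by
    refine measurable_to_countable' fun A => ?_
    have : (fun t : ℝ => univ.filter fun i => t < x i) ⁻¹' {A} =
        ⋂ i, {t : ℝ | t < x i ↔ i ∈ A} := by
      ext t
      simp [Finset.ext_iff]
    rw [this]
    refine MeasurableSet.iInter fun i => ?_
    by_cases hi : i ∈ A
    · simp only [hi, iff_true]
      exact measurableSet_Iio
    · simp only [hi, iff_false, not_lt]
      exact measurableSet_Ici
  exact (measurable_from_top (f := h)).comp hmeas

theorem intervalIntegrable_superlevel {n : ℕ} (h : Finset (Fin n) → ℝ) (x : Fin n → ℝ)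
    (a b : ℝ) :
    IntervalIntegrable (fun t : ℝ => h (univ.filter fun i => t < x i)) volume a b := by
  rw [intervalIntegrable_iff]
  refine Measure.integrableOn_of_bounded (M := ∑ A, |h A|) (by simp)
    (measurable_superlevel h x).aestronglyMeasurable (ae_of_all _ fun t => ?_)
  exact Finset.single_le_sum (f := fun A => |h A|) (fun A _ => abs_nonneg _) (mem_univ _)

/-- The range of integration in the Lovász extension may be enlarged. -/
theorem lovasz_eq_integral {n : ℕ} (hn : 0 < n) (h : Finset (Fin n) → ℝ) (hh0 : h ∅ = 0)
    (x : Fin n → ℝ) {a b : ℝ} (ha : ∀ i, a ≤ x i) (hb : ∀ i, x i ≤ b) :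
    lovasz h x = (∫ t in a..b, h (univ.filter fun i => t < x i)) + h univ * a := by
  have : Nonempty (Fin n) := ⟨⟨0, hn⟩⟩
  have hlow : ∫ t in a..(⨅ i, x i), h (univ.filter fun i => t < x i) =
      h univ * ((⨅ i, x i) - a) := by
    have : ∫ t in a..(⨅ i, x i), h (univ.filter fun i => t < x i) =
        ∫ _ in a..(⨅ i, x i), h univ := by
      refine intervalIntegral.integral_congr_ae ?_
      filter_upwards [(Set.finite_singleton (⨅ i, x i)).measure_zero volume |>
        compl_mem_ae_iff.2] with t ht hmem
      rw [Set.uIoc_of_le (le_ciInf ha)] at hmem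
      have htm : t < ⨅ i, x i := lt_of_le_of_ne hmem.2 ht
      rw [Finset.filter_true_of_mem fun i _ =>
        htm.trans_le (ciInf_le (Set.finite_range x).bddBelow i)]
    rw [this, intervalIntegral.integral_const, smul_eq_mul, mul_comm]
  have hhigh : ∫ t in (⨆ i, x i)..b, h (univ.filter fun i => t < x i) = 0 := by
    refine intervalIntegral.integral_zero_ae (ae_of_all _ fun t hmem => ?_)
    rw [Set.uIoc_of_le (ciSup_le hb)] at hmem
    rw [Finset.filter_false_of_mem fun i _ =>
      ((le_ciSup (Set.finite_range x).bddAbove i).trans hmem.1.le).not_gt, hh0]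
  have hI := intervalIntegrable_superlevel h x
  rw [← intervalIntegral.integral_add_adjacent_intervals (hI a (⨅ i, x i)) (hI _ b),
    ← intervalIntegral.integral_add_adjacent_intervals (hI (⨅ i, x i) (⨆ i, x i)) (hI _ b),
    hlow, hhigh, lovasz]
  ring

theorem abs_le_iSup_abs {n : ℕ} (x : Fin n → ℝ) (i : Fin n) : |x i| ≤ ⨆ j, |x j| :=
  le_ciSup (f := fun j => |x j|) (Set.finite_range _).bddAbove i

theorem iSup_abs_nonneg {n : ℕ} (x : Fin n → ℝ) : 0 ≤ ⨆ j, |x j| :=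
  Real.iSup_nonneg fun _ => abs_nonneg _

/-- At the positive part of `x`, the Lovász extension integrates over the superlevel sets of `x` at nonnegative heights. -/
theorem lovasz_max_zero {n : ℕ} (hn : 0 < n) (h : Finset (Fin n) → ℝ) (hh0 : h ∅ = 0)
    (x : Fin n → ℝ) {b : ℝ} (hb0 : 0 ≤ b) (hb : ∀ i, x i ≤ b) :
    lovasz h (fun i => max (x i) 0) = ∫ t in (0 : ℝ)..b, h (univ.filter fun i => t < x i) := by
  rw [lovasz_eq_integral hn h hh0 _ (fun i => le_max_right _ _) (fun i => max_le (hb i) hb0),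
    mul_zero, add_zero]
  refine intervalIntegral.integral_congr_ae (ae_of_all _ fun t hmem => ?_)
  rw [Set.uIoc_of_le hb0] at hmem
  simp [hmem.1.le.not_gt]

theorem disjoint_superlevel_neg {n : ℕ} (x : Fin n → ℝ) {t : ℝ} (ht : 0 ≤ t) :
    Disjoint (univ.filter fun i => t < x i) (univ.filter fun i => t < -x i) := by
  refine Finset.disjoint_filter.2 fun i _ h1 h2 => ?_
  linarith

/-- Only the values on disjoint pairs matter for the disjoint-pair Lovász extension. -/
theorem dpLovasz_congr {n : ℕ} {f g : Finset (Fin n) → Finset (Fin n) → ℝ}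
    (hfg : ∀ A B, Disjoint A B → f A B = g A B) (x : Fin n → ℝ) :
    dpLovasz f x = dpLovasz g x := by
  refine intervalIntegral.integral_congr_ae (ae_of_all _ fun t hmem => ?_)
  rw [Set.uIoc_of_le (iSup_abs_nonneg x)] at hmem
  exact hfg _ _ (disjoint_superlevel_neg x hmem.1.le)

theorem dpLovasz_compl_eq_lovasz {n : ℕ} (hn : 0 < n) (h : Finset (Fin n) → ℝ) (hh0 : h ∅ = 0)
    (x : Fin n → ℝ) :
    dpLovasz (fun A B => h A + h (univ \ B) - h univ) x = lovasz h x := by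
  set R := ⨆ i, |x i| with hR
  have hI := intervalIntegrable_superlevel h x
  have hJ : IntervalIntegrable
      (fun t : ℝ => h (univ \ univ.filter fun i => t < -x i)) volume 0 R :=
    intervalIntegrable_superlevel (fun B => h (univ \ B)) (fun i => -x i) 0 R
  have hneg : ∫ t in (0 : ℝ)..R, h (univ \ univ.filter fun i => t < -x i) =
      ∫ t in (-R)..0, h (univ.filter fun i => t < x i) := by
    have hcomp := intervalIntegral.integral_comp_neg (a := 0) (b := R)
      (fun t : ℝ => h (univ.filter fun i => t < x i))
    rw [neg_zero] at hcomp
    rw [← hcomp]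
    refine intervalIntegral.integral_congr_ae ?_
    filter_upwards [(Set.finite_range fun i => -x i).measure_zero volume |>
      compl_mem_ae_iff.2] with t ht _
    congr 1
    ext i
    have hne : -x i ≠ t := fun e => ht ⟨i, e⟩
    simp only [mem_sdiff, mem_filter, mem_univ, true_and, not_lt]
    constructor
    · intro hle
      linarith [lt_of_le_of_ne hle hne]
    · intro hlt
      linarith
  rw [lovasz_eq_integral hn h hh0 x (a := -R) (b := R)
      (fun i => neg_le_of_abs_le (abs_le_iSup_abs x i))
      (fun i => (le_abs_self _).trans (abs_le_iSup_abs x i)),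
    ← intervalIntegral.integral_add_adjacent_intervals (hI (-R) 0) (hI 0 R), ← hneg, dpLovasz,
    ← hR, intervalIntegral.integral_sub ((hI 0 R).add hJ) intervalIntegrable_const,
    intervalIntegral.integral_add (hI 0 R) hJ, intervalIntegral.integral_const, smul_eq_mul]
  ring

/-- Relations between the disjoint-pair and the original Lovász extensions:
(a) if `f(A,B) = h(A) + h(V∖B) − h(V)` then `f^L = h^L`;
(b) if `f(A,B) = h(A) + h(B)` and `h` is symmetric then `f^L = h^L`;
(c) if `f(A,B) = h(A) ± h(B)` then `f^L(x) = h^L(x⁺) ± h^L(x⁻)`. -/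
theorem stmt_7 {n : ℕ} (hn : 0 < n)
    (h : Finset (Fin n) → ℝ) (hhnn : ∀ A, 0 ≤ h A) (hh0 : h ∅ = 0)
    (f : Finset (Fin n) → Finset (Fin n) → ℝ)
    (hfnn : ∀ A B : Finset (Fin n), Disjoint A B → 0 ≤ f A B) (hf0 : f ∅ ∅ = 0) :
    ((∀ A B : Finset (Fin n), Disjoint A B → f A B = h A + h (univ \ B) - h univ) →
      ∀ x : Fin n → ℝ, dpLovasz f x = lovasz h x) ∧
    ((∀ A : Finset (Fin n), h A = h (univ \ A)) →
      (∀ A B : Finset (Fin n), Disjoint A B → f A B = h A + h B) →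
      ∀ x : Fin n → ℝ, dpLovasz f x = lovasz h x) ∧
    ((∀ A B : Finset (Fin n), Disjoint A B → f A B = h A + h B) →
      ∀ x : Fin n → ℝ,
        dpLovasz f x =
          lovasz h (fun i => max (x i) 0) + lovasz h (fun i => max (-x i) 0)) ∧
    ((∀ A B : Finset (Fin n), Disjoint A B → f A B = h A - h B) →
      ∀ x : Fin n → ℝ,
        dpLovasz f x =
          lovasz h (fun i => max (x i) 0) - lovasz h (fun i => max (-x i) 0)) := by
  have hpos (x : Fin n → ℝ) := lovasz_max_zero hn h hh0 x (iSup_abs_nonneg x)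
    fun i => (le_abs_self _).trans (abs_le_iSup_abs x i)
  have hneg (x : Fin n → ℝ) := lovasz_max_zero hn h hh0 (fun i => -x i) (iSup_abs_nonneg x)
    fun i => (neg_le_abs _).trans (abs_le_iSup_abs x i)
  refine ⟨fun hf x => ?_, fun hsymm hf x => ?_, fun hf x => ?_, fun hf x => ?_⟩
  · rw [dpLovasz_congr hf, dpLovasz_compl_eq_lovasz hn h hh0]
  · have huniv : h univ = 0 := by
      rw [hsymm, sdiff_self]
      exact hh0
    rw [← dpLovasz_compl_eq_lovasz hn h hh0]
    refine dpLovasz_congr (fun A B hAB => ?_) x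
    rw [hf A B hAB, ← hsymm B, huniv, sub_zero]
  · rw [dpLovasz_congr hf, hpos, hneg]
    exact intervalIntegral.integral_add (intervalIntegrable_superlevel h x _ _)
      (intervalIntegrable_superlevel h (fun i => -x i) _ _)
  · rw [dpLovasz_congr hf, hpos, hneg]
    exact intervalIntegral.integral_sub (intervalIntegrable_superlevel h x _ _)
      (intervalIntegrable_superlevel h (fun i => -x i) _ _)
end

section
/- Let V be a nonempty finite set. Every function f : 𝒫(V) → ℝ can be written as f = f₁ − f₂, where f₁, f₂ : 𝒫(V) → ℝ are submodular; moreover, f₂ can be chosen strictly submodular on incomparable pairs, i.e., f₂(A) + f₂(B) > f₂(A∪B) + f₂(A∩B) whenever A ⊄ B and B ⊄ A. -/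
/-- A set function `g : 𝒫(V) → ℝ` is submodular if
`g(A) + g(B) ≥ g(A∪B) + g(A∩B)` for all `A, B ⊆ V`. -/
def Submodular {V : Type*} [DecidableEq V] (g : Finset V → ℝ) : Prop :=
  ∀ A B : Finset V, g (A ∪ B) + g (A ∩ B) ≤ g A + g B

/-- On incomparable pairs, the squared cardinality is supermodular with gap at least two. -/
theorem Finset.sq_card_add_sq_card_add_two_le {V : Type*} [DecidableEq V] {A B : Finset V}
    (hAB : ¬A ⊆ B) (hBA : ¬B ⊆ A) :
    (A.card : ℝ) ^ 2 + (B.card : ℝ) ^ 2 + 2 ≤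
      ((A ∪ B).card : ℝ) ^ 2 + ((A ∩ B).card : ℝ) ^ 2 := by
  have hunion : ((A ∪ B).card : ℝ) + (A ∩ B).card = A.card + B.card :=
    mod_cast Finset.card_union_add_card_inter A B
  have hA : ((A \ B).card : ℝ) + (A ∩ B).card = A.card :=
    mod_cast Finset.card_sdiff_add_card_inter A B
  have hB : ((B \ A).card : ℝ) + (A ∩ B).card = B.card := by
    rw [Finset.inter_comm]
    exact_mod_cast Finset.card_sdiff_add_card_inter B A
  have hA_pos : (1 : ℝ) ≤ (A \ B).card :=
    mod_cast Finset.card_pos.mpr (Finset.sdiff_nonempty.mpr hAB)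
  have hB_pos : (1 : ℝ) ≤ (B \ A).card :=
    mod_cast Finset.card_pos.mpr (Finset.sdiff_nonempty.mpr hBA)
  have hU : ((A ∪ B).card : ℝ) = (A \ B).card + (B \ A).card + (A ∩ B).card := by linarith
  rw [hU, ← hA, ← hB]
  nlinarith [one_le_mul_of_one_le_of_one_le hA_pos hB_pos]

/-- Submodularity only needs to be checked on incomparable pairs. -/
theorem Submodular.of_incomparable {V : Type*} [DecidableEq V] {g : Finset V → ℝ}
    (h : ∀ A B : Finset V, ¬A ⊆ B → ¬B ⊆ A → g (A ∪ B) + g (A ∩ B) ≤ g A + g B) :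
    Submodular g := by
  intro A B
  by_cases hAB : A ⊆ B
  · rw [Finset.union_eq_right.mpr hAB, Finset.inter_eq_left.mpr hAB, add_comm]
  by_cases hBA : B ⊆ A
  · rw [Finset.union_eq_left.mpr hBA, Finset.inter_eq_right.mpr hBA]
  exact h A B hAB hBA

/-- Every set function `f : 𝒫(V) → ℝ` on a nonempty finite set `V` can be
written as a difference `f = f₁ − f₂` of submodular functions, with `f₂` strictly submodular
on incomparable pairs. -/
theorem stmt_10 {V : Type*} [Fintype V] [DecidableEq V] [Nonempty V]
    (f : Finset V → ℝ) :
    ∃ f₁ f₂ : Finset V → ℝ, Submodular f₁ ∧ Submodular f₂ ∧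
      (∀ A : Finset V, f A = f₁ A - f₂ A) ∧
      (∀ A B : Finset V, ¬A ⊆ B → ¬B ⊆ A →
        f₂ (A ∪ B) + f₂ (A ∩ B) < f₂ A + f₂ B) := by
  set S : ℝ := ∑ A, |f A|
  have hf (A : Finset V) : |f A| ≤ S :=
    Finset.single_le_sum (f := fun A => |f A|) (fun _ _ => abs_nonneg _) (Finset.mem_univ A)
  have hS_nonneg : 0 ≤ S := Finset.sum_nonneg fun _ _ => abs_nonneg _
  have hgap (A B : Finset V) (hAB : ¬A ⊆ B) (hBA : ¬B ⊆ A) :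
      -(2 * S + 1) * ((A ∪ B).card : ℝ) ^ 2 + -(2 * S + 1) * ((A ∩ B).card : ℝ) ^ 2 +
        (4 * S + 2) ≤
      -(2 * S + 1) * (A.card : ℝ) ^ 2 + -(2 * S + 1) * (B.card : ℝ) ^ 2 := by
    have hc : 0 ≤ 2 * S + 1 := by linarith
    linarith [mul_le_mul_of_nonneg_left (Finset.sq_card_add_sq_card_add_two_le hAB hBA) hc]
  refine ⟨fun A => f A + -(2 * S + 1) * (A.card : ℝ) ^ 2,
    fun A => -(2 * S + 1) * (A.card : ℝ) ^ 2,
    .of_incomparable fun A B hAB hBA => ?_, .of_incomparable fun A B hAB hBA => ?_,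
    fun A => by ring, fun A B hAB hBA => ?_⟩
  · linarith [hgap A B hAB hBA, (abs_le.mp (hf (A ∪ B))).2, (abs_le.mp (hf (A ∩ B))).2,
      (abs_le.mp (hf A)).1, (abs_le.mp (hf B)).1]
  · linarith [hgap A B hAB hBA]
  · linarith [hgap A B hAB hBA]
end

section
/- Let (V, E, w) be a finite weighted undirected graph with V = {1,…,n}, n ≥ 2, and edge weights w_{ij} ≥ 0. Then the minimum cut satisfies min over ∅ ≠ S ⊊ V of Σ_{{i,j} ∈ E with exactly one endpoint in S} w_{ij} = min over x ∈ ℝ^n ∖ {0} with min_i x_i + max_i x_i = 0 of (Σ_{{i,j} ∈ E} w_{ij}|x_i − x_j|) / (2‖x‖_∞), and the minimum on the right-hand side is attained. -/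
open Finset

/-- For symmetric weights, the total variation is the sum of the positive parts. -/
lemma half_sum_mul_abs_sub_eq {ι : Type*} [Fintype ι] (w : ι → ι → ℝ)
    (hsymm : ∀ i j, w i j = w j i) (x : ι → ℝ) :
    (1 / 2) * ∑ i, ∑ j, w i j * |x i - x j| = ∑ i, ∑ j, w i j * max (x i - x j) 0 := by
  have hswap : ∑ i, ∑ j, w i j * max (x j - x i) 0 = ∑ i, ∑ j, w i j * max (x i - x j) 0 := by
    rw [Finset.sum_comm]
    exact Finset.sum_congr rfl fun i _ => Finset.sum_congr rfl fun j _ => by rw [hsymm]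
  have hsplit : ∑ i, ∑ j, w i j * |x i - x j| =
      ∑ i, ∑ j, w i j * max (x i - x j) 0 + ∑ i, ∑ j, w i j * max (x j - x i) 0 := by
    simp only [← Finset.sum_add_distrib, ← mul_add]
    refine Finset.sum_congr rfl fun i _ => Finset.sum_congr rfl fun j _ => ?_
    congr 1
    rcases le_total (x i) (x j) with h | h
    · rw [abs_of_nonpos (by linarith), max_eq_right (by linarith), max_eq_left (by linarith)]
      ring
    · rw [abs_of_nonneg (by linarith), max_eq_left (by linarith), max_eq_right (by linarith)]
      ring
  rw [hsplit, hswap]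
  ring

/-- The cut value as a double sum over all pairs of vertices. -/
lemma cut_eq_sum_ite {ι : Type*} [Fintype ι] [DecidableEq ι] (w : ι → ι → ℝ) (T : Finset ι) :
    ∑ i ∈ T, ∑ j ∈ Tᶜ, w i j = ∑ i, ∑ j, w i j * (if i ∈ T ∧ j ∉ T then 1 else 0) := by
  rw [← Finset.sum_filter_add_sum_filter_not univ (· ∈ T)
    (fun i => ∑ j, w i j * (if i ∈ T ∧ j ∉ T then 1 else 0))]
  have hzero : ∑ i ∈ univ.filter (· ∉ T), ∑ j, w i j * (if i ∈ T ∧ j ∉ T then (1 : ℝ) else 0)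
      = 0 := by
    refine Finset.sum_eq_zero fun i hi => Finset.sum_eq_zero fun j _ => ?_
    simp [(Finset.mem_filter.mp hi).2]
  rw [hzero, add_zero, Finset.filter_univ_mem]
  refine Finset.sum_congr rfl fun i hi => ?_
  simp only [hi, true_and, mul_ite, mul_one, mul_zero]
  rw [← Finset.sum_filter]
  congr 1
  ext j
  simp

/-- A lower bound `c` for all cuts bounds the total variation by the coarea formula. -/
lemma mul_sub_le_sum_mul_max {ι : Type*} [Fintype ι] [DecidableEq ι] (w : ι → ι → ℝ)
    (hnn : ∀ i j, 0 ≤ w i j) (c : ℝ)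
    (hc : ∀ T : Finset ι, T ≠ ∅ → T ≠ univ → c ≤ ∑ i ∈ T, ∑ j ∈ Tᶜ, w i j)
    (x : ι → ℝ) (a b : ι) (hab : x a ≤ x b) :
    c * (x b - x a) ≤ ∑ i, ∑ j, w i j * max (x i - x j) 0 := by
  have hint (u v : ℝ) : MeasureTheory.Integrable ((Set.Ico u v).indicator fun _ => (1 : ℝ)) :=
    (MeasureTheory.integrable_indicator_iff measurableSet_Ico).mpr
      (MeasureTheory.integrableOn_const (by simp))
  have hval (u v : ℝ) : ∫ t, (Set.Ico u v).indicator (fun _ => (1 : ℝ)) t = max (v - u) 0 := by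
    rw [MeasureTheory.integral_indicator_const _ measurableSet_Ico, Real.volume_real_Ico]
    simp
  have hmono : ∫ t, c * (Set.Ico (x a) (x b)).indicator (fun _ => (1 : ℝ)) t ≤
      ∫ t, ∑ i, ∑ j, w i j * (Set.Ico (x j) (x i)).indicator (fun _ => (1 : ℝ)) t := by
    refine MeasureTheory.integral_mono ((hint _ _).const_mul c)
      (MeasureTheory.integrable_finsetSum _ fun i _ =>
        MeasureTheory.integrable_finsetSum _ fun j _ => (hint _ _).const_mul _) fun t => ?_
    by_cases ht : t ∈ Set.Ico (x a) (x b)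
    · have hcut := hc (univ.filter fun i => t < x i)
        (Finset.ne_empty_of_mem (a := b) (by simpa using ht.2))
        (fun h => by
          have ha := h ▸ Finset.mem_univ a
          exact absurd (Finset.mem_filter.mp ha).2 (not_lt.mpr ht.1))
      rw [cut_eq_sum_ite] at hcut
      simp only [Set.indicator_of_mem ht, mul_one]
      refine hcut.trans_eq
        (Finset.sum_congr rfl fun i _ => Finset.sum_congr rfl fun j _ => ?_)
      simp [Set.indicator_apply, and_comm]
    · simp only [Set.indicator_of_notMem ht, mul_zero]
      exact Finset.sum_nonneg fun i _ => Finset.sum_nonneg fun j _ =>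
        mul_nonneg (hnn i j) (Set.indicator_nonneg (fun _ _ => zero_le_one) t)
  rw [MeasureTheory.integral_const_mul, hval, max_eq_left (by linarith),
    MeasureTheory.integral_finsetSum _ fun i _ =>
      MeasureTheory.integrable_finsetSum _ fun j _ => (hint _ _).const_mul _] at hmono
  refine hmono.trans_eq (Finset.sum_congr rfl fun i _ => ?_)
  rw [MeasureTheory.integral_finsetSum _ fun j _ => (hint _ _).const_mul _]
  simp only [MeasureTheory.integral_const_mul, hval]

/-- Continuous reformulation of the min-cut problem:
`min_{∅ ≠ S ⊊ V} |∂S| = min over x ≠ 0 with min_i x_i + max_i x_i = 0 of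
(Σ_{{i,j} ∈ E} w_{ij}|x_i − x_j|) / (2‖x‖_∞)`, the minimum on the right being attained.
Edges are encoded by a symmetric nonnegative weight function `w`, the cut value of `S` is
`Σ_{i ∈ S} Σ_{j ∉ S} w i j` and `Σ_{{i,j} ∈ E} w_{ij}|x_i − x_j| =
(1/2) Σ_i Σ_j w i j |x_i − x_j|`. -/
theorem stmt_12 {n : ℕ} (hn : 2 ≤ n) (w : Fin n → Fin n → ℝ)
    (hsymm : ∀ i j, w i j = w j i) (hnn : ∀ i j, 0 ≤ w i j) :
    ∃ S : Finset (Fin n), S ≠ ∅ ∧ S ≠ univ ∧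
      (∀ T : Finset (Fin n), T ≠ ∅ → T ≠ univ →
        ∑ i ∈ S, ∑ j ∈ Sᶜ, w i j ≤ ∑ i ∈ T, ∑ j ∈ Tᶜ, w i j) ∧
      IsLeast {r : ℝ | ∃ x : Fin n → ℝ, x ≠ 0 ∧ (⨅ i, x i) + (⨆ i, x i) = 0 ∧
          r = ((1 / 2) * ∑ i, ∑ j, w i j * |x i - x j|) / (2 * ⨆ i, |x i|)}
        (∑ i ∈ S, ∑ j ∈ Sᶜ, w i j) := by
  have : Nontrivial (Fin n) := Fin.nontrivial_iff_two_le.mpr hn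
  obtain ⟨S, hS, hmin⟩ := Finset.exists_min_image
    (univ.filter fun T : Finset (Fin n) => T ≠ ∅ ∧ T ≠ univ)
    (fun T => ∑ i ∈ T, ∑ j ∈ Tᶜ, w i j) (by
      obtain ⟨a, b, hab⟩ := exists_pair_ne (Fin n)
      refine ⟨{a}, Finset.mem_filter.mpr ⟨mem_univ _, singleton_ne_empty a, fun h => hab ?_⟩⟩
      exact (Finset.mem_singleton.mp (h ▸ mem_univ b)).symm)
  simp only [mem_filter, mem_univ, true_and, and_imp] at hS hmin
  refine ⟨S, hS.1, hS.2, hmin, ?_, ?_⟩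
  · obtain ⟨a, ha⟩ := Finset.nonempty_iff_ne_empty.mpr hS.1
    obtain ⟨b, hb⟩ : ∃ b, b ∉ S := by
      simpa [Finset.eq_univ_iff_forall] using hS.2
    set x : Fin n → ℝ := fun i => if i ∈ S then 1 else -1 with hx
    have hxa : x a = 1 := if_pos ha
    have hxb : x b = -1 := if_neg hb
    have hle (i : Fin n) : x i ≤ 1 := by simp only [hx]; split_ifs <;> norm_num
    have hge (i : Fin n) : -1 ≤ x i := by simp only [hx]; split_ifs <;> norm_num
    have hsup : ⨆ i, x i = 1 :=
      le_antisymm (ciSup_le hle) (hxa ▸ le_ciSup (Set.finite_range x).bddAbove a)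
    have hinf : ⨅ i, x i = -1 :=
      le_antisymm (hxb ▸ ciInf_le (Set.finite_range x).bddBelow b) (le_ciInf hge)
    have habs : ⨆ i, |x i| = 1 := by
      have (i : Fin n) : |x i| = 1 := by simp only [hx]; split_ifs <;> norm_num
      simp [this]
    refine ⟨x, fun h => by simp [h] at hxa, by rw [hsup, hinf]; norm_num, ?_⟩
    rw [habs, half_sum_mul_abs_sub_eq w hsymm, cut_eq_sum_ite, mul_one, eq_div_iff two_ne_zero,
      Finset.sum_mul]
    refine Finset.sum_congr rfl fun i _ => ?_
    rw [Finset.sum_mul]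
    refine Finset.sum_congr rfl fun j _ => ?_
    by_cases hi : i ∈ S <;> by_cases hj : j ∈ S <;> norm_num [hx, hi, hj]
  · rintro r ⟨x, hx0, hx, rfl⟩
    obtain ⟨a, ha⟩ := exists_eq_ciInf_of_finite (f := x)
    obtain ⟨b, hb⟩ := exists_eq_ciSup_of_finite (f := x)
    have hle (i) : x i ≤ x b := hb ▸ le_ciSup (Set.finite_range x).bddAbove i
    have hge (i) : x a ≤ x i := ha ▸ ciInf_le (Set.finite_range x).bddBelow i
    rw [← ha, ← hb] at hx
    have habs : ⨆ i, |x i| = x b :=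
      le_antisymm (ciSup_le fun i => abs_le.mpr ⟨by linarith [hge i], hle i⟩)
        ((le_abs_self _).trans (le_ciSup (Set.finite_range fun i => |x i|).bddAbove b))
    have hpos : 0 < x b := by
      by_contra! h
      exact hx0 (funext fun i => le_antisymm ((hle i).trans h) (by simp; linarith [hge i]))
    rw [habs, le_div_iff₀ (by linarith), half_sum_mul_abs_sub_eq w hsymm]
    have := mul_sub_le_sum_mul_max w hnn _ hmin x a b (hge b)
    rwa [show x b - x a = 2 * x b by linarith] at this
end

section
/- Let (V, E, w) be a finite weighted undirected graph with V = {1,…,n}, n ≥ 1, and edge weights w_{ij} ≥ 0, and let p ≥ 1. Then the maximum cut satisfies max_{S ⊆ V} Σ_{{i,j} ∈ E with exactly one endpoint in S} w_{ij} = max over x ∈ ℝ^n ∖ {0} of (Σ_{{i,j} ∈ E} w_{ij}|x_i − x_j|^p) / (2‖x‖_∞)^p = max over x ∈ ℝ^n with ‖x‖_∞ ≤ 1/2 of Σ_{{i,j} ∈ E} w_{ij}|x_i − x_j|^p, and these maxima are attained. -/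
open Finset

/-- The `p`-energy of the vector equal to `1 / 2` on `T` and `-1 / 2` off `T` is the cut value
of `T`. -/
theorem energy_of_cut_vector {ι : Type*} [Fintype ι] [DecidableEq ι] (w : ι → ι → ℝ)
    (hsymm : ∀ i j, w i j = w j i) {p : ℝ} (hp : p ≠ 0) (T : Finset ι) (x : ι → ℝ)
    (hx : ∀ i, x i = if i ∈ T then 1 / 2 else -(1 / 2)) :
    (1 / 2) * ∑ i, ∑ j, w i j * |x i - x j| ^ p = ∑ i ∈ T, ∑ j ∈ Tᶜ, w i j := by
  have hcut : ∑ i ∈ T, ∑ j ∈ Tᶜ, w i j = ∑ i, ∑ j, if i ∈ T ∧ j ∉ T then w i j else 0 := by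
    rw [← Finset.sum_filter_add_sum_filter_not univ (· ∈ T)
      (fun i => ∑ j, if i ∈ T ∧ j ∉ T then w i j else 0)]
    rw [Finset.sum_eq_zero (s := univ.filter (fun i => ¬ i ∈ T)), add_zero, Finset.filter_univ_mem]
    · refine Finset.sum_congr rfl fun i hi => ?_
      rw [← Finset.sum_filter]
      refine Finset.sum_congr ?_ fun _ _ => rfl
      ext j
      simp [hi]
    · intro i hi
      refine Finset.sum_eq_zero fun j _ => ?_
      simp_all
  have hcut' : ∑ i ∈ T, ∑ j ∈ Tᶜ, w i j = ∑ i, ∑ j, if j ∈ T ∧ i ∉ T then w i j else 0 := by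
    rw [hcut, Finset.sum_comm]
    refine Finset.sum_congr rfl fun i _ => Finset.sum_congr rfl fun j _ => ?_
    rw [hsymm]
  have hsum : ∑ i, ∑ j, w i j * |x i - x j| ^ p
      = (∑ i, ∑ j, if i ∈ T ∧ j ∉ T then w i j else 0)
        + ∑ i, ∑ j, if j ∈ T ∧ i ∉ T then w i j else 0 := by
    simp_rw [← Finset.sum_add_distrib]
    refine Finset.sum_congr rfl fun i _ => Finset.sum_congr rfl fun j _ => ?_
    rw [hx i, hx j]
    by_cases hi : i ∈ T <;> by_cases hj : j ∈ T <;> simp [hi, hj, Real.zero_rpow hp] <;> norm_num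
  rw [hsum, ← hcut, ← hcut']
  ring

theorem convexOn_energy {ι : Type*} [Fintype ι] (w : ι → ι → ℝ) (hnn : ∀ i j, 0 ≤ w i j) :
    ConvexOn ℝ Set.univ fun x : ι → ℝ => (1 / 2) * ∑ i, ∑ j, w i j * |x i - x j| ^ (1 : ℝ) := by
  refine ⟨convex_univ, fun x _ y _ a b ha hb _ => ?_⟩
  simp only [Real.rpow_one, smul_eq_mul, Pi.add_apply, Pi.smul_apply]
  have hle : ∑ i, ∑ j, w i j * |a * x i + b * y i - (a * x j + b * y j)|
      ≤ ∑ i, ∑ j, (a * (w i j * |x i - x j|) + b * (w i j * |y i - y j|)) := by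
    refine Finset.sum_le_sum fun i _ => Finset.sum_le_sum fun j _ => ?_
    calc w i j * |a * x i + b * y i - (a * x j + b * y j)|
        = w i j * |a * (x i - x j) + b * (y i - y j)| := by ring_nf
      _ ≤ w i j * (|a * (x i - x j)| + |b * (y i - y j)|) :=
        mul_le_mul_of_nonneg_left (abs_add_le _ _) (hnn i j)
      _ = _ := by rw [abs_mul, abs_mul, abs_of_nonneg ha, abs_of_nonneg hb]; ring
  simp only [Finset.sum_add_distrib, ← Finset.mul_sum] at hle
  linarith

/-- On the cube `‖x‖_∞ ≤ 1 / 2`, the `p`-energy is at most some cut value. -/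
theorem exists_energy_le_cut {ι : Type*} [Fintype ι] [DecidableEq ι] (w : ι → ι → ℝ)
    (hsymm : ∀ i j, w i j = w j i) (hnn : ∀ i j, 0 ≤ w i j) {p : ℝ} (hp : 1 ≤ p)
    (x : ι → ℝ) (hx : ∀ i, |x i| ≤ 1 / 2) :
    ∃ T : Finset ι,
      (1 / 2) * ∑ i, ∑ j, w i j * |x i - x j| ^ p ≤ ∑ i ∈ T, ∑ j ∈ Tᶜ, w i j := by
  have hmem : x ∈ convexHull ℝ (Set.univ.pi fun _ : ι => ({-(1 / 2), 1 / 2} : Set ℝ)) := by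
    rw [convexHull_pi]
    intro i _
    rw [convexHull_pair, segment_eq_Icc (by norm_num)]
    exact abs_le.mp (hx i)
  obtain ⟨y, hy, hxy⟩ :=
    ((convexOn_energy w hnn).subset (Set.subset_univ _) (convex_convexHull ℝ _)
      ).exists_ge_of_mem_convexHull (subset_convexHull ℝ _) hmem
  refine ⟨univ.filter fun i => y i = 1 / 2, ?_⟩
  rw [← energy_of_cut_vector w hsymm one_ne_zero _ y]
  · refine le_trans ?_ hxy
    refine mul_le_mul_of_nonneg_left ?_ (by norm_num)
    refine Finset.sum_le_sum fun i _ => Finset.sum_le_sum fun j _ => ?_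
    refine mul_le_mul_of_nonneg_left ?_ (hnn i j)
    refine Real.rpow_le_rpow_of_exponent_ge' (abs_nonneg _) ?_ zero_le_one hp
    linarith [abs_sub (x i) (x j), hx i, hx j]
  · intro i
    rcases hy i (Set.mem_univ i) with h | h
    · have hne : y i ≠ 1 / 2 := by rw [h]; norm_num
      rw [if_neg (by simpa only [mem_filter, mem_univ, true_and] using hne), h]
    · rw [Set.mem_singleton_iff] at h
      simp [h]

/-- The `p`-energy is homogeneous of degree `p`. -/
theorem energy_div {ι : Type*} [Fintype ι] (w : ι → ι → ℝ) (p : ℝ) (x : ι → ℝ) {c : ℝ}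
    (hc : 0 ≤ c) :
    (1 / 2) * ∑ i, ∑ j, w i j * |x i / c - x j / c| ^ p
      = ((1 / 2) * ∑ i, ∑ j, w i j * |x i - x j| ^ p) / c ^ p := by
  simp_rw [← sub_div, abs_div, abs_of_nonneg hc, Real.div_rpow (abs_nonneg _) hc, ← mul_div_assoc,
    ← Finset.sum_div]
  ring

/-- Continuous reformulations of the max-cut problem, for `p ≥ 1`:
`max_{S ⊆ V} |∂S| = max_{x ≠ 0} (Σ_{{i,j} ∈ E} w_{ij}|x_i − x_j|^p)/(2‖x‖_∞)^p
= max_{‖x‖_∞ ≤ 1/2} Σ_{{i,j} ∈ E} w_{ij}|x_i − x_j|^p`, all maxima being attained.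
Edges are encoded by a symmetric nonnegative weight function `w`; the cut value of `S` is
`Σ_{i ∈ S} Σ_{j ∉ S} w i j`, and `Σ_{{i,j} ∈ E} w_{ij}|x_i − x_j|^p =
(1/2) Σ_i Σ_j w i j |x_i − x_j|^p`. -/
theorem stmt_13 {n : ℕ} (hn : 1 ≤ n) (w : Fin n → Fin n → ℝ)
    (hsymm : ∀ i j, w i j = w j i) (hnn : ∀ i j, 0 ≤ w i j)
    (p : ℝ) (hp : 1 ≤ p) :
    ∃ S : Finset (Fin n),
      (∀ T : Finset (Fin n), ∑ i ∈ T, ∑ j ∈ Tᶜ, w i j ≤ ∑ i ∈ S, ∑ j ∈ Sᶜ, w i j) ∧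
      IsGreatest {r : ℝ | ∃ x : Fin n → ℝ, x ≠ 0 ∧
          r = ((1 / 2) * ∑ i, ∑ j, w i j * |x i - x j| ^ p) / (2 * ⨆ i, |x i|) ^ p}
        (∑ i ∈ S, ∑ j ∈ Sᶜ, w i j) ∧
      IsGreatest {r : ℝ | ∃ x : Fin n → ℝ, (∀ i, |x i| ≤ 1 / 2) ∧
          r = (1 / 2) * ∑ i, ∑ j, w i j * |x i - x j| ^ p}
        (∑ i ∈ S, ∑ j ∈ Sᶜ, w i j) := by
  classical
  obtain ⟨S, -, hS⟩ := Finset.exists_max_image (univ : Finset (Finset (Fin n)))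
    (fun T => ∑ i ∈ T, ∑ j ∈ Tᶜ, w i j) univ_nonempty
  replace hS T := hS T (mem_univ T)
  have : Nonempty (Fin n) := ⟨⟨0, hn⟩⟩
  have hbound (x : Fin n → ℝ) (hx : ∀ i, |x i| ≤ 1 / 2) :
      (1 / 2) * ∑ i, ∑ j, w i j * |x i - x j| ^ p ≤ ∑ i ∈ S, ∑ j ∈ Sᶜ, w i j := by
    obtain ⟨T, hT⟩ := exists_energy_le_cut w hsymm hnn hp x hx
    exact hT.trans (hS T)
  let z : Fin n → ℝ := fun i => if i ∈ S then 1 / 2 else -(1 / 2)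
  have hz := energy_of_cut_vector w hsymm (by linarith : p ≠ 0) S z fun _ => rfl
  have habs (i : Fin n) : |z i| = 1 / 2 := by
    by_cases h : i ∈ S <;> simp [z, h]
  refine ⟨S, hS, ⟨⟨z, ?_, ?_⟩, ?_⟩, ⟨⟨z, fun i => (habs i).le, hz.symm⟩, ?_⟩⟩
  · intro h
    have h0 := habs ⟨0, hn⟩
    norm_num [h] at h0
  · rw [hz]
    simp [habs]
  · rintro r ⟨x, hx, rfl⟩
    have hle (i : Fin n) : |x i| ≤ ⨆ i, |x i| :=
      le_ciSup (f := fun i => |x i|) (Set.finite_range _).bddAbove i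
    obtain ⟨k, hk⟩ := Function.ne_iff.mp hx
    have hpos : 0 < ⨆ i, |x i| := (abs_pos.mpr hk).trans_le (hle k)
    rw [← energy_div w p x (by positivity)]
    refine hbound (fun i => x i / (2 * ⨆ i, |x i|)) fun i => ?_
    rw [abs_div, abs_of_pos (by positivity : 0 < 2 * ⨆ i, |x i|), div_le_iff₀ (by positivity)]
    linarith [hle i]
  · rintro r ⟨x, hx, rfl⟩
    exact hbound x hx
end

section
/- Let G = (V, E) be a finite simple graph with V = {1,…,n}, n ≥ 1, and write deg_i = #{j ∈ V : {i,j} ∈ E}. Then the independence number satisfies α(G) = max over x ∈ ℝ^n ∖ {0} of (‖x‖₁ − Σ_{{i,j} ∈ E} min{|x_i|, |x_j|}) / ‖x‖_∞ = max over x ∈ ℝ^n ∖ {0} of (Σ_{{i,j} ∈ E}(|x_i − x_j| + |x_i + x_j|) − 2 Σ_{i ∈ V} (deg_i − 1)|x_i|) / (2‖x‖_∞), and these maxima are attained. -/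
open Finset

/-- Every vertex subset `A` contains an independent set `S` whose weight bounds the weight of `A`
minus the sum of the smaller endpoint weights over the edges inside `A`. -/
lemma exists_indep_sum_sub_edge_min_le {V : Type*} [DecidableEq V] (G : SimpleGraph V)
    [DecidableRel G.Adj] (y : V → ℝ) (hy : ∀ i, 0 ≤ y i) (A : Finset V) :
    ∃ S ⊆ A, (∀ i ∈ S, ∀ j ∈ S, ¬G.Adj i j) ∧
      (∑ i ∈ A, y i) - (1 / 2) * ∑ i ∈ A, ∑ j ∈ A, (if G.Adj i j then min (y i) (y j) else 0) ≤
        ∑ i ∈ S, y i := by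
  induction A using Finset.induction_on_min_value y with
  | empty => exact ⟨∅, by simp⟩
  | insert a B haB hmin ih =>
    obtain ⟨S, hSB, hS, hle⟩ := ih
    have hrow : ∑ j ∈ B, (if G.Adj a j then min (y a) (y j) else 0) =
        ∑ j ∈ B, (if G.Adj a j then y a else 0) :=
      sum_congr rfl fun j hj ↦ by rw [min_eq_left (hmin j hj)]
    have hcol : ∑ i ∈ B, (if G.Adj i a then min (y i) (y a) else 0) =
        ∑ j ∈ B, (if G.Adj a j then y a else 0) :=
      sum_congr rfl fun i hi ↦ by simp only [min_eq_right (hmin i hi), G.adj_comm i a]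
    have hsum : (∑ i ∈ insert a B, y i) - (1 / 2) * ∑ i ∈ insert a B, ∑ j ∈ insert a B,
          (if G.Adj i j then min (y i) (y j) else 0) =
        ((∑ i ∈ B, y i) -
          (1 / 2) * ∑ i ∈ B, ∑ j ∈ B, (if G.Adj i j then min (y i) (y j) else 0)) +
          (y a - ∑ j ∈ B, (if G.Adj a j then y a else 0)) := by
      simp only [sum_insert haB, sum_add_distrib, hrow, hcol, G.irrefl, if_false]
      ring
    have hnonneg : ∀ j ∈ B, 0 ≤ (if G.Adj a j then y a else 0) := fun j _ ↦ by
      split_ifs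
      exacts [hy a, le_rfl]
    rw [hsum]
    by_cases h : ∃ j ∈ S, G.Adj a j
    · obtain ⟨j, hj, haj⟩ := h
      refine ⟨S, hSB.trans (subset_insert a B), hS, ?_⟩
      have hsingle := single_le_sum hnonneg (hSB hj)
      rw [if_pos haj] at hsingle
      linarith
    · push Not at h
      refine ⟨insert a S, insert_subset_insert a hSB, ?_, ?_⟩
      · intro i hi j hj
        rcases mem_insert.1 hi with rfl | hiS <;> rcases mem_insert.1 hj with rfl | hjS
        · exact G.irrefl
        · exact h j hjS
        · exact fun hij ↦ h i hiS hij.symm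
        · exact hS i hiS j hjS
      · rw [sum_insert fun ha ↦ haB (hSB ha)]
        linarith [sum_nonneg hnonneg]

lemma abs_sub_add_abs_add_eq (a b : ℝ) :
    |a - b| + |a + b| = 2 * (|a| + |b| - min |a| |b|) := by
  rcases abs_cases a with ⟨h1, _⟩ | ⟨h1, _⟩ <;> rcases abs_cases b with ⟨h2, _⟩ | ⟨h2, _⟩ <;>
    rcases abs_cases (a - b) with ⟨h3, _⟩ | ⟨h3, _⟩ <;>
    rcases abs_cases (a + b) with ⟨h4, _⟩ | ⟨h4, _⟩ <;>
    rcases min_cases |a| |b| with ⟨h5, _⟩ | ⟨h5, _⟩ <;> linarith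

lemma edge_abs_sum_sub_degree_sum_eq {V : Type*} [Fintype V] (G : SimpleGraph V)
    [DecidableRel G.Adj] (x : V → ℝ) :
    (1 / 2) * (∑ i, ∑ j, (if G.Adj i j then |x i - x j| + |x i + x j| else 0)) -
        2 * ∑ i, ((G.degree i : ℝ) - 1) * |x i| =
      2 * ((∑ i, |x i|) -
        (1 / 2) * ∑ i, ∑ j, (if G.Adj i j then min |x i| |x j| else 0)) := by
  have hrow : ∑ i, ∑ j, (if G.Adj i j then |x i| else 0) = ∑ i, (G.degree i : ℝ) * |x i| :=
    sum_congr rfl fun i _ ↦ by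
      rw [← sum_filter, sum_const, ← G.neighborFinset_eq_filter, G.card_neighborFinset_eq_degree,
        nsmul_eq_mul]
  have hcol : ∑ i, ∑ j, (if G.Adj i j then |x j| else 0) = ∑ i, (G.degree i : ℝ) * |x i| := by
    rw [sum_comm, ← hrow]
    simp only [G.adj_comm]
  have hedge : ∑ i, ∑ j, (if G.Adj i j then |x i - x j| + |x i + x j| else 0) =
      2 * ((∑ i, ∑ j, (if G.Adj i j then |x i| else 0)) +
        (∑ i, ∑ j, (if G.Adj i j then |x j| else 0)) -
        ∑ i, ∑ j, (if G.Adj i j then min |x i| |x j| else 0)) := by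
    simp only [← sum_add_distrib, ← sum_sub_distrib, mul_sum]
    refine sum_congr rfl fun i _ ↦ sum_congr rfl fun j _ ↦ ?_
    split_ifs
    · exact abs_sub_add_abs_add_eq _ _
    · simp
  rw [hedge, hrow, hcol]
  simp only [sub_mul, one_mul, sum_sub_distrib]
  ring

/-- Continuous representations of the independence number:
`α(G) = max_{x ≠ 0} (‖x‖₁ − Σ_{{i,j} ∈ E} min{|x_i|,|x_j|}) / ‖x‖_∞
      = max_{x ≠ 0} (Σ_{{i,j} ∈ E}(|x_i − x_j| + |x_i + x_j|) − 2Σ_i (deg_i − 1)|x_i|) / (2‖x‖_∞)`,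
with maxima attained. Sums over unordered edges are written as half double sums. -/
theorem stmt_15 {n : ℕ} (hn : 0 < n) (G : SimpleGraph (Fin n)) [DecidableRel G.Adj] :
    ∃ S : Finset (Fin n), (∀ i ∈ S, ∀ j ∈ S, ¬G.Adj i j) ∧
      (∀ T : Finset (Fin n), (∀ i ∈ T, ∀ j ∈ T, ¬G.Adj i j) → T.card ≤ S.card) ∧
      IsGreatest {r : ℝ | ∃ x : Fin n → ℝ, x ≠ 0 ∧
          r = ((∑ i, |x i|) -
                (1 / 2) * ∑ i, ∑ j, (if G.Adj i j then min |x i| |x j| else 0)) /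
              (⨆ i, |x i|)} (S.card : ℝ) ∧
      IsGreatest {r : ℝ | ∃ x : Fin n → ℝ, x ≠ 0 ∧
          r = ((1 / 2) * (∑ i, ∑ j,
                  (if G.Adj i j then |x i - x j| + |x i + x j| else 0)) -
                2 * ∑ i, ((G.degree i : ℝ) - 1) * |x i|) /
              (2 * ⨆ i, |x i|)} (S.card : ℝ) := by
  obtain ⟨S, hSmem, hSmax⟩ := exists_max_image
    (univ.filter fun T : Finset (Fin n) ↦ ∀ i ∈ T, ∀ j ∈ T, ¬G.Adj i j) card ⟨∅, by simp⟩
  have hS : ∀ i ∈ S, ∀ j ∈ S, ¬G.Adj i j := (mem_filter.1 hSmem).2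
  replace hSmax : ∀ T : Finset (Fin n), (∀ i ∈ T, ∀ j ∈ T, ¬G.Adj i j) → T.card ≤ S.card :=
    fun T hT ↦ hSmax T (mem_filter.2 ⟨mem_univ T, hT⟩)
  have hfirst : IsGreatest {r : ℝ | ∃ x : Fin n → ℝ, x ≠ 0 ∧
      r = ((∑ i, |x i|) -
            (1 / 2) * ∑ i, ∑ j, (if G.Adj i j then min |x i| |x j| else 0)) /
          (⨆ i, |x i|)} (S.card : ℝ) := by
    constructor
    · obtain ⟨v, hv⟩ : S.Nonempty := card_pos.1 (by simpa using hSmax {⟨0, hn⟩} (by simp))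
      have habs : ∀ i, |if i ∈ S then (1 : ℝ) else 0| = if i ∈ S then 1 else 0 := fun i ↦ by
        split_ifs <;> simp
      refine ⟨fun i ↦ if i ∈ S then 1 else 0, fun h ↦ ?_, ?_⟩
      · simpa [hv] using congrFun h v
      have hsup : ⨆ i, (if i ∈ S then (1 : ℝ) else 0) = 1 := by
        have : Nonempty (Fin n) := ⟨v⟩
        refine le_antisymm (ciSup_le fun i ↦ by split_ifs <;> simp) ?_
        simpa [hv] using le_ciSup (f := fun i ↦ if i ∈ S then (1 : ℝ) else 0)
          (Set.finite_range _).bddAbove v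
      have hedge : ∑ i, ∑ j, (if G.Adj i j then
          min (if i ∈ S then (1 : ℝ) else 0) (if j ∈ S then 1 else 0) else 0) = 0 :=
        sum_eq_zero fun i _ ↦ sum_eq_zero fun j _ ↦ by
          have := hS i
          split_ifs <;> simp_all
      simp only [habs, hsup, hedge]
      simp
    · rintro r ⟨x, hx, rfl⟩
      obtain ⟨v, hv⟩ := Function.ne_iff.1 hx
      have hle : ∀ i, |x i| ≤ ⨆ i, |x i| :=
        le_ciSup (f := fun i ↦ |x i|) (Set.finite_range _).bddAbove
      have hpos : 0 < ⨆ i, |x i| := (abs_pos.2 hv).trans_le (hle v)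
      obtain ⟨T, -, hT, hsum⟩ :=
        exists_indep_sum_sub_edge_min_le G (fun i ↦ |x i|) (fun i ↦ abs_nonneg _) univ
      rw [div_le_iff₀ hpos]
      calc _ ≤ ∑ i ∈ T, |x i| := hsum
        _ ≤ T.card * ⨆ i, |x i| := by
          simpa using sum_le_card_nsmul T (fun i ↦ |x i|) _ fun i _ ↦ hle i
        _ ≤ S.card * ⨆ i, |x i| :=
          mul_le_mul_of_nonneg_right (mod_cast hSmax T hT) hpos.le
  refine ⟨S, hS, hSmax, hfirst, ?_⟩
  simpa only [edge_abs_sum_sub_degree_sum_eq, mul_div_mul_left _ _ (two_ne_zero' ℝ)] using hfirst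
end

section
/- Let (V, E) be a finite simple graph with V = {1,…,n}, n ≥ 1, whose edge set is partitioned into positive edges E₊ and negative edges E₋ (a signed graph, with sign s_{ij} = 1 for {i,j} ∈ E₊ and s_{ij} = −1 for {i,j} ∈ E₋). Then min over A ⊆ V of ( |E₊(A, V∖A)| + |E₋(A)| + |E₋(V∖A)| ) = |E₋| + min over x ∈ ℝ^n ∖ {0} of (Σ_{{i,j} ∈ E₊} |x_i − x_j| − Σ_{{i,j} ∈ E₋} |x_i − x_j|) / (2‖x‖_∞), where E₊(A, V∖A) is the set of positive edges with exactly one endpoint in A and E₋(A) is the set of negative edges with both endpoints in A; moreover this common value equals one half of the frustration index min over x ∈ {−1,1}^n of Σ_{{i,j} ∈ E} |x_i − s_{ij} x_j|. -/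
open Finset

/-- The `{0,1}`-valued edge-indicator weight of a simple graph. -/
noncomputable def ew {n : ℕ} (G : SimpleGraph (Fin n)) [DecidableRel G.Adj] :
    Fin n → Fin n → ℝ := fun i j => if G.Adj i j then 1 else 0

open MeasureTheory in
/-- Threshold formula for the distance of two points of `[-M, M]`. -/
theorem integrableOn_and_setIntegral_threshold {M a b : ℝ} (ha : |a| ≤ M) (hb : |b| ≤ M) :
    IntegrableOn (fun t : ℝ =>
      |(if t < a then (1 : ℝ) else -1) - (if t < b then 1 else -1)|) (Set.Icc (-M) M) ∧
    ∫ t in Set.Icc (-M) M, |(if t < a then (1 : ℝ) else -1) - (if t < b then 1 else -1)|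
      = 2 * |a - b| := by
  have hfun : (fun t : ℝ => |(if t < a then (1 : ℝ) else -1) - (if t < b then 1 else -1)|)
      = (Set.Ico (min a b) (max a b)).indicator (fun _ => (2 : ℝ)) := by
    funext t
    simp only [Set.indicator_apply, Set.mem_Ico, min_le_iff, lt_max_iff]
    by_cases h1 : t < a <;> by_cases h2 : t < b
    · simp [h1, h2]
    · simp [h1, h2, not_lt.mp h2]; norm_num
    · simp [h1, h2, not_lt.mp h1]; norm_num
    · simp [h1, h2]
  rw [hfun]
  constructor
  · exact (integrableOn_const (by simp)).indicator measurableSet_Ico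
  · rw [abs_le] at ha hb
    have hsub : Set.Icc (-M) M ∩ Set.Ico (min a b) (max a b)
        = Set.Ico (min a b) (max a b) := by
      apply Set.inter_eq_right.mpr
      intro t ht
      exact ⟨(le_min ha.1 hb.1).trans ht.1, ht.2.le.trans (max_le ha.2 hb.2)⟩
    rw [setIntegral_indicator measurableSet_Ico, hsub, setIntegral_const,
      Real.volume_real_Ico_of_le min_le_max, max_sub_min_eq_abs, smul_eq_mul, abs_sub_comm]
    ring

open MeasureTheory in
/-- A lower bound for a weighted total variation on cuts extends to the cube `[-M, M]^ι`. -/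
theorem mul_le_sum_abs_sub_of_forall_cut {ι : Type*} [Fintype ι] [DecidableEq ι]
    (w : ι → ι → ℝ) (c : ℝ)
    (hc : ∀ A : Finset ι, c ≤ ∑ i, ∑ j,
      w i j * |(if i ∈ A then (1 : ℝ) else -1) - (if j ∈ A then 1 else -1)|)
    {M : ℝ} (x : ι → ℝ) (hM : 0 ≤ M) (hx : ∀ i, |x i| ≤ M) :
    M * c ≤ ∑ i, ∑ j, w i j * |x i - x j| := by
  have hint : ∀ i j, IntegrableOn (fun t : ℝ =>
      w i j * |(if t < x i then (1 : ℝ) else -1) - (if t < x j then 1 else -1)|)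
      (Set.Icc (-M) M) := fun i j =>
    (integrableOn_and_setIntegral_threshold (hx i) (hx j)).1.const_mul _
  have hmono : ∫ _ in Set.Icc (-M) M, c ≤ ∫ t in Set.Icc (-M) M, ∑ i, ∑ j,
      w i j * |(if t < x i then (1 : ℝ) else -1) - (if t < x j then 1 else -1)| := by
    apply integral_mono
    · exact integrableOn_const (by simp)
    · exact integrable_finsetSum _ fun i _ => integrable_finsetSum _ fun j _ => hint i j
    · intro t
      simpa using hc (univ.filter fun i => t < x i)
  rw [integral_finsetSum _ fun i _ => integrable_finsetSum _ fun j _ => hint i j,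
    setIntegral_const, Real.volume_real_Icc_of_le (by linarith), smul_eq_mul] at hmono
  have hval : ∑ i, ∫ t in Set.Icc (-M) M, ∑ j,
      w i j * |(if t < x i then (1 : ℝ) else -1) - (if t < x j then 1 else -1)|
      = 2 * ∑ i, ∑ j, w i j * |x i - x j| := by
    simp_rw [Finset.mul_sum]
    refine Finset.sum_congr rfl fun i _ => ?_
    rw [integral_finsetSum _ fun j _ => hint i j]
    refine Finset.sum_congr rfl fun j _ => ?_
    rw [integral_const_mul, (integrableOn_and_setIntegral_threshold (hx i) (hx j)).2]
    ring
  linarith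

theorem ew_comm {n : ℕ} (G : SimpleGraph (Fin n)) [DecidableRel G.Adj] (i j : Fin n) :
    ew G i j = ew G j i := by
  simp [ew, G.adj_comm]

/-- The edges violated by the bipartition `A, Aᶜ`, in terms of the sign vector of `A`. -/
theorem violated_edges_eq {n : ℕ} (Gp Gm : SimpleGraph (Fin n))
    [DecidableRel Gp.Adj] [DecidableRel Gm.Adj] (A : Finset (Fin n)) :
    (∑ i ∈ A, ∑ j ∈ Aᶜ, ew Gp i j) + (1 / 2) * (∑ i ∈ A, ∑ j ∈ A, ew Gm i j) +
      (1 / 2) * (∑ i ∈ Aᶜ, ∑ j ∈ Aᶜ, ew Gm i j) =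
    (1 / 2) * (∑ i, ∑ j, ew Gm i j) + (1 / 4) * ∑ i, ∑ j, (ew Gp i j - ew Gm i j) *
      |(if i ∈ A then (1 : ℝ) else -1) - (if j ∈ A then 1 else -1)| := by
  have hsplit : ∀ f : Fin n → Fin n → ℝ, ∑ i, ∑ j, f i j =
      (∑ i ∈ A, ∑ j ∈ A, f i j) + (∑ i ∈ A, ∑ j ∈ Aᶜ, f i j) +
      (∑ i ∈ Aᶜ, ∑ j ∈ A, f i j) + (∑ i ∈ Aᶜ, ∑ j ∈ Aᶜ, f i j) := by
    intro f
    have h (i : Fin n) : ∑ j, f i j = ∑ j ∈ A, f i j + ∑ j ∈ Aᶜ, f i j :=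
      (Finset.sum_add_sum_compl A _).symm
    rw [← Finset.sum_add_sum_compl A]
    simp only [h, Finset.sum_add_distrib]
    ring
  have hsymm : ∀ (G : SimpleGraph (Fin n)) [DecidableRel G.Adj],
      ∑ i ∈ Aᶜ, ∑ j ∈ A, ew G i j = ∑ i ∈ A, ∑ j ∈ Aᶜ, ew G i j := by
    intro G _
    rw [Finset.sum_comm]
    exact Finset.sum_congr rfl fun i _ => Finset.sum_congr rfl fun j _ => ew_comm G j i
  have key : ∀ (S T : Finset (Fin n)) (r : ℝ), (∀ i ∈ S, ∀ j ∈ T,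
      |(if i ∈ A then (1 : ℝ) else -1) - (if j ∈ A then 1 else -1)| = r) →
      ∑ i ∈ S, ∑ j ∈ T, (ew Gp i j - ew Gm i j) *
        |(if i ∈ A then (1 : ℝ) else -1) - (if j ∈ A then 1 else -1)| =
      r * (∑ i ∈ S, ∑ j ∈ T, ew Gp i j - ∑ i ∈ S, ∑ j ∈ T, ew Gm i j) := by
    intro S T r h
    simp only [← Finset.sum_sub_distrib, Finset.mul_sum]
    refine Finset.sum_congr rfl fun i hi => Finset.sum_congr rfl fun j hj => ?_
    rw [h i hi j hj, mul_comm]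
  rw [hsplit (ew Gm), hsplit (fun i j => (ew Gp i j - ew Gm i j) * _),
    key A A 0 (by intro i hi j hj; simp [hi, hj]),
    key A Aᶜ 2 (by intro i hi j hj; rw [Finset.mem_compl] at hj; simp [hi, hj]; norm_num),
    key Aᶜ A 2 (by intro i hi j hj; rw [Finset.mem_compl] at hi; simp [hi, hj]; norm_num),
    key Aᶜ Aᶜ 0 (by intro i hi j hj; rw [Finset.mem_compl] at hi hj; simp [hi, hj]),
    hsymm Gp, hsymm Gm]
  ring

/-- The frustration functional at a sign vector, in terms of a weighted total variation. -/
theorem frustration_eq {n : ℕ} (Gp Gm : SimpleGraph (Fin n))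
    [DecidableRel Gp.Adj] [DecidableRel Gm.Adj] (x : Fin n → ℝ)
    (hx : ∀ i, x i = 1 ∨ x i = -1) :
    (1 / 2) * ∑ i, ∑ j, (ew Gp i j * |x i - x j| + ew Gm i j * |x i + x j|) =
    (∑ i, ∑ j, ew Gm i j) + (1 / 2) * ∑ i, ∑ j, (ew Gp i j - ew Gm i j) * |x i - x j| := by
  simp only [Finset.mul_sum, ← Finset.sum_add_distrib]
  refine Finset.sum_congr rfl fun i _ => Finset.sum_congr rfl fun j _ => ?_
  have h : |x i + x j| = 2 - |x i - x j| := by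
    rcases hx i with h1 | h1 <;> rcases hx j with h2 | h2 <;> rw [h1, h2] <;> norm_num
  rw [h]
  ring

/-- For a signed graph given by disjoint positive/negative edge sets
`E₊` (graph `Gp`) and `E₋` (graph `Gm`):
`min_{A ⊆ V} (|E₊(A,V∖A)| + |E₋(A)| + |E₋(V∖A)|)
 = |E₋| + min_{x ≠ 0} (Σ_{E₊}|x_i−x_j| − Σ_{E₋}|x_i−x_j|)/(2‖x‖_∞)`,
and this common value is half the frustration index
`min_{x ∈ {−1,1}^n} Σ_{{i,j} ∈ E} |x_i − s_{ij} x_j|`.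
Sums over unordered edges are written as half double sums; `|E₊(A,V∖A)| =
Σ_{i ∈ A} Σ_{j ∉ A} 1_{E₊}(i,j)`. -/
theorem stmt_17 {n : ℕ} (hn : 0 < n)
    (Gp Gm : SimpleGraph (Fin n)) [DecidableRel Gp.Adj] [DecidableRel Gm.Adj]
    (hdisj : ∀ i j, ¬(Gp.Adj i j ∧ Gm.Adj i j)) :
    ∃ m mc fr : ℝ,
      IsLeast {r : ℝ | ∃ A : Finset (Fin n),
          r = (∑ i ∈ A, ∑ j ∈ Aᶜ, ew Gp i j) +
              (1 / 2) * (∑ i ∈ A, ∑ j ∈ A, ew Gm i j) +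
              (1 / 2) * (∑ i ∈ Aᶜ, ∑ j ∈ Aᶜ, ew Gm i j)} m ∧
      IsLeast {r : ℝ | ∃ x : Fin n → ℝ, x ≠ 0 ∧
          r = ((1 / 2) * ∑ i, ∑ j,
                  (ew Gp i j * |x i - x j| - ew Gm i j * |x i - x j|)) /
              (2 * ⨆ i, |x i|)} mc ∧
      m = (1 / 2) * (∑ i, ∑ j, ew Gm i j) + mc ∧
      IsLeast {r : ℝ | ∃ x : Fin n → ℝ, (∀ i, x i = 1 ∨ x i = -1) ∧
          r = (1 / 2) * ∑ i, ∑ j,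
                (ew Gp i j * |x i - x j| + ew Gm i j * |x i + x j|)} fr ∧
      m = fr / 2 := by
  classical
  have : Nonempty (Fin n) := ⟨⟨0, hn⟩⟩
  let y : Finset (Fin n) → Fin n → ℝ := fun A i => if i ∈ A then 1 else -1
  let g : (Fin n → ℝ) → ℝ := fun x => ∑ i, ∑ j, (ew Gp i j - ew Gm i j) * |x i - x j|
  have hy : ∀ A i, y A i = 1 ∨ y A i = -1 := by
    intro A i
    by_cases h : i ∈ A <;> simp [y, h]
  obtain ⟨A₀, hA₀⟩ := Finite.exists_min fun A => g (y A)
  refine ⟨(1 / 2) * (∑ i, ∑ j, ew Gm i j) + (1 / 4) * g (y A₀), (1 / 4) * g (y A₀),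
    (∑ i, ∑ j, ew Gm i j) + (1 / 2) * g (y A₀), ⟨⟨A₀, ?_⟩, ?_⟩, ⟨⟨y A₀, ?_, ?_⟩, ?_⟩, rfl,
    ⟨⟨y A₀, hy A₀, ?_⟩, ?_⟩, by ring⟩
  · exact (violated_edges_eq Gp Gm A₀).symm
  · rintro r ⟨A, rfl⟩
    rw [violated_edges_eq]
    have := hA₀ A
    simp only [g, y] at this ⊢
    linarith
  · intro h
    have h0 := congrFun h ⟨0, hn⟩
    rcases hy A₀ ⟨0, hn⟩ with h1 | h1 <;> rw [h1] at h0 <;> norm_num at h0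
  · have habs : ∀ i, |y A₀ i| = 1 := fun i => by
      rcases hy A₀ i with h | h <;> simp [h]
    simp only [habs, ciSup_const, g, sub_mul]
    ring
  · rintro r ⟨x, hx, rfl⟩
    have hle : ∀ i, |x i| ≤ ⨆ i, |x i| := le_ciSup (Set.finite_range _).bddAbove
    obtain ⟨k, hk⟩ := Function.ne_iff.mp hx
    have hpos : 0 < ⨆ i, |x i| := (abs_pos.mpr hk).trans_le (hle k)
    have h := mul_le_sum_abs_sub_of_forall_cut (fun i j => ew Gp i j - ew Gm i j) (g (y A₀))
      hA₀ x hpos.le hle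
    rw [le_div_iff₀ (by positivity)]
    simp only [sub_mul] at h
    linarith
  · exact (frustration_eq Gp Gm (y A₀) (hy A₀)).symm
  · rintro r ⟨x, hx, rfl⟩
    rw [frustration_eq Gp Gm x hx]
    have hxy : y (univ.filter fun i => x i = 1) = x := by
      funext i
      rcases hx i with h | h <;> simp [y, h]
      norm_num
    have h := hA₀ (univ.filter fun i => x i = 1)
    rw [hxy] at h
    simp only [g] at h ⊢
    linarith
end

section
/- Let S ⊆ ℝ^d be a nonempty compact set and F, G : S → ℝ continuous with G(x) > 0 for all x ∈ S. Let x⁰ ∈ S, r⁰ = F(x⁰)/G(x⁰), and suppose the sequences (x^k) in S and (r^k) in ℝ satisfy, for all k ≥ 0: x^{k+1} minimizes x ↦ F(x) − r^k G(x) over S, and r^{k+1} = F(x^{k+1})/G(x^{k+1}). Then the sequence (r^k) is non-increasing and converges to the global minimum min_{x ∈ S} F(x)/G(x). The analogous statement holds with minimization replaced by maximization: if x^{k+1} maximizes F(x) − r^k G(x) over S, then (r^k) is non-decreasing and converges to max_{x ∈ S} F(x)/G(x). -/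
open Filter Topology

/-- The Dinkelbach iteration for minimizing `F / G` over a compact set decreases to the minimum. -/
theorem dinkelbach_antitone_tendsto_min {X : Type*} [TopologicalSpace X] {S : Set X}
    (hSne : S.Nonempty) (hScomp : IsCompact S) {F G : X → ℝ}
    (hF : ContinuousOn F S) (hG : ContinuousOn G S) (hGpos : ∀ y ∈ S, 0 < G y)
    {x : ℕ → X} {r : ℕ → ℝ} (hxS : ∀ k, x k ∈ S) (hr : ∀ k, r k = F (x k) / G (x k))
    (hmin : ∀ k, ∀ y ∈ S, F (x (k + 1)) - r k * G (x (k + 1)) ≤ F y - r k * G y) :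
    Antitone r ∧ ∃ m : ℝ, IsLeast {v : ℝ | ∃ y ∈ S, v = F y / G y} m ∧
      Tendsto r atTop (𝓝 m) := by
  obtain ⟨z, hzS, hz⟩ :=
    hScomp.exists_isMinOn hSne (hF.div hG fun y hy => (hGpos y hy).ne')
  obtain ⟨w, hwS, hw⟩ := hScomp.exists_isMaxOn hSne hG
  have hzG := hGpos z hzS
  have hFr : ∀ k, F (x k) = r k * G (x k) := fun k => by
    rw [hr k, div_mul_cancel₀ _ (hGpos _ (hxS k)).ne']
  have hle : ∀ k, F z / G z ≤ r k := fun k => by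
    rw [hr k]
    exact hz (hxS k)
  have hanti : Antitone r := antitone_nat_of_succ_le fun k => by
    have h := hmin k (x k) (hxS k)
    rw [hFr, hFr k, sub_self, ← sub_mul] at h
    exact sub_nonpos.1 (nonpos_of_mul_nonpos_left h (hGpos _ (hxS _)))
  have hstep : ∀ k, r k - F z / G z ≤ (r k - r (k + 1)) * (G w / G z) := fun k => by
    have h := hmin k z hzS
    rw [hFr] at h
    have hGw : (r k - r (k + 1)) * G (x (k + 1)) ≤ (r k - r (k + 1)) * G w :=
      mul_le_mul_of_nonneg_left (hw (hxS _)) (sub_nonneg.2 (hanti k.le_succ))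
    rw [← mul_div_assoc, le_div_iff₀ hzG, sub_mul, div_mul_cancel₀ _ hzG.ne']
    linarith
  refine ⟨hanti, F z / G z, ⟨⟨z, hzS, rfl⟩, ?_⟩, ?_⟩
  · rintro _ ⟨y, hy, rfl⟩
    exact hz hy
  · have hlim := tendsto_atTop_ciInf hanti ⟨F z / G z, by rintro _ ⟨k, rfl⟩; exact hle k⟩
    have hdiff : Tendsto (fun k => (r k - r (k + 1)) * (G w / G z)) atTop (𝓝 0) := by
      simpa using (hlim.sub (hlim.comp (tendsto_add_atTop_nat 1))).mul_const (G w / G z)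
    exact tendsto_sub_nhds_zero_iff.1
      (squeeze_zero (fun k => sub_nonneg.2 (hle k)) hstep hdiff)

/-- Global convergence of the Dinkelbach-type two-step iterative scheme
for fractional programming: on a nonempty compact `S` with `F, G` continuous and `G > 0`,
if `x^{k+1}` minimizes `F(·) − r^k G(·)` over `S` and `r^{k+1} = F(x^{k+1})/G(x^{k+1})`,
then `(r^k)` is non-increasing and converges to `min_{x ∈ S} F(x)/G(x)`; dually with
maximization, `(r^k)` is non-decreasing and converges to `max_{x ∈ S} F(x)/G(x)`. -/
theorem stmt_18 {d : ℕ} (S : Set (Fin d → ℝ)) (hSne : S.Nonempty) (hScomp : IsCompact S)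
    (F G : (Fin d → ℝ) → ℝ) (hF : ContinuousOn F S) (hG : ContinuousOn G S)
    (hGpos : ∀ x ∈ S, 0 < G x)
    (x : ℕ → Fin d → ℝ) (r : ℕ → ℝ)
    (hx0 : x 0 ∈ S) (hr0 : r 0 = F (x 0) / G (x 0))
    (hxS : ∀ k, x (k + 1) ∈ S)
    (hr : ∀ k, r (k + 1) = F (x (k + 1)) / G (x (k + 1))) :
    ((∀ k, ∀ y ∈ S, F (x (k + 1)) - r k * G (x (k + 1)) ≤ F y - r k * G y) →
      Antitone r ∧ ∃ mval : ℝ, IsLeast {v : ℝ | ∃ y ∈ S, v = F y / G y} mval ∧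
        Tendsto r atTop (nhds mval)) ∧
    ((∀ k, ∀ y ∈ S, F y - r k * G y ≤ F (x (k + 1)) - r k * G (x (k + 1))) →
      Monotone r ∧ ∃ mval : ℝ, IsGreatest {v : ℝ | ∃ y ∈ S, v = F y / G y} mval ∧
        Tendsto r atTop (nhds mval)) := by
  have hxS' : ∀ k, x k ∈ S := fun k => by cases k <;> simp [hx0, hxS]
  have hr' : ∀ k, r k = F (x k) / G (x k) := fun k => by
    cases k with
    | zero => exact hr0
    | succ k => exact hr k
  refine ⟨dinkelbach_antitone_tendsto_min hSne hScomp hF hG hGpos hxS' hr', fun hmax => ?_⟩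
  obtain ⟨hanti, m, ⟨⟨z, hzS, hz⟩, hm⟩, hlim⟩ :=
    dinkelbach_antitone_tendsto_min (F := fun y => -F y) (r := fun k => -r k)
      hSne hScomp hF.neg hG hGpos hxS' (fun k => by rw [hr' k, neg_div])
      (fun k y hy => by linarith [hmax k y hy])
  refine ⟨fun i j hij => neg_le_neg_iff.1 (hanti hij), -m, ⟨⟨z, hzS, ?_⟩, ?_⟩, ?_⟩
  · rw [hz, neg_div, neg_neg]
  · rintro _ ⟨y, hy, rfl⟩
    have h := hm ⟨y, hy, rfl⟩
    rw [neg_div] at h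
    exact le_neg_of_le_neg h
  · simpa using hlim.neg
end
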